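/- arXiv:2511.04844 — 2 statements merged into one kernel-verified Lean document; each statement's English description precedes it below -/
import Mathlib

section
/- Let μ be any probability measure on ℝ^d and let t > 0. For x ∈ ℝ^d, let ν_{t,x} be the probability measure on ℝ^d defined by dν_{t,x}(y) ∝ exp(−‖x − e^{−t} y‖²/(2(1−e^{−2t}))) dμ(y). Then p_t is smooth and strictly positive, ν_{t,x} has finite second moment, and for every x ∈ ℝ^d the Hessian of log p_t satisfies ∇²log p_t(x) = −(1/(1−e^{−2t})) I_d + (e^{−2t}/(1−e^{−2t})²)·Cov(ν_{t,x}), where Cov(ν_{t,x}) denotes the covariance matrix of ν_{t,x}. -/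
open MeasureTheory Real
open scoped RealInnerProductSpace ENNReal Classical

noncomputable section

/-- `Euc d` is Euclidean space `ℝ^d`. -/
abbrev Euc (d : ℕ) := EuclideanSpace ℝ (Fin d)

/-- The standard Gaussian measure `N(0, I_d)` on `ℝ^d`. -/
def stdGaussian (d : ℕ) : Measure (Euc d) :=
  volume.withDensity fun x =>
    ENNReal.ofReal ((2 * π) ^ (-(d : ℝ) / 2) * Real.exp (-‖x‖ ^ 2 / 2))

/-- The density `p_t` of the Ornstein–Uhlenbeck flow of `μ` at time `t`. -/
def ouDensity (d : ℕ) (μ : Measure (Euc d)) (t : ℝ) (x : Euc d) : ℝ :=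
  (2 * π * (1 - Real.exp (-2 * t))) ^ (-(d : ℝ) / 2) *
    ∫ y, Real.exp (-‖x - Real.exp (-t) • y‖ ^ 2 / (2 * (1 - Real.exp (-2 * t)))) ∂μ

/-- The Ornstein–Uhlenbeck flow `μ_t` of `μ` at time `t`, i.e. the measure with
density `p_t` with respect to Lebesgue measure. -/
def ouFlow (d : ℕ) (μ : Measure (Euc d)) (t : ℝ) : Measure (Euc d) :=
  volume.withDensity fun x => ENNReal.ofReal (ouDensity d μ t x)

/-- The relative score `x ↦ ∇ log p_t(x) + x` of `μ_t`. -/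
def relScore (d : ℕ) (μ : Measure (Euc d)) (t : ℝ) (x : Euc d) : Euc d :=
  gradient (fun z => Real.log (ouDensity d μ t z)) x + x

/-- The relative Fisher information `FI(μ_t ‖ γ_d) = ∫ ‖∇ log p_t + x‖² dμ_t`. -/
def relFisher (d : ℕ) (μ : Measure (Euc d)) (t : ℝ) : ℝ :=
  ∫ x, ‖relScore d μ t x‖ ^ 2 ∂(ouFlow d μ t)

/-- Kullback–Leibler divergence `KL(ρ ‖ σ)`. -/
def KLdiv {α : Type*} [MeasurableSpace α] (ρ σ : Measure α) : ℝ≥0∞ :=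
  if ρ ≪ σ then ENNReal.ofReal (∫ x, Real.log ((ρ.rnDeriv σ x).toReal) ∂ρ) else ⊤

/-- The tilted measure `ν_{t,x}` with `dν_{t,x}(y) ∝ exp(−‖x − e^{−t}y‖²/(2(1−e^{−2t}))) dμ(y)`. -/
def tiltedMeasure (d : ℕ) (μ : Measure (Euc d)) (t : ℝ) (x : Euc d) : Measure (Euc d) :=
  (ENNReal.ofReal
      (∫ y, Real.exp (-‖x - Real.exp (-t) • y‖ ^ 2 / (2 * (1 - Real.exp (-2 * t)))) ∂μ))⁻¹ •
    μ.withDensity fun y =>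
      ENNReal.ofReal (Real.exp (-‖x - Real.exp (-t) • y‖ ^ 2 / (2 * (1 - Real.exp (-2 * t)))))

section ExponentialIntegral

universe u

variable {α : Type*} [MeasurableSpace α] {μ : Measure α}

/-- `g` is integrable against every exponential `exp (R * ‖Y‖)`. -/
def ExpIntegrable {E G : Type*} [NormedAddCommGroup E] [NormedAddCommGroup G]
    (μ : Measure α) (Y : α → E) (g : α → G) : Prop :=
  AEStronglyMeasurable g μ ∧ ∀ R : ℝ, Integrable (fun ω => Real.exp (R * ‖Y ω‖) * ‖g ω‖) μ

theorem ExpIntegrable.of_norm_le_norm_mul {E G H : Type*} [NormedAddCommGroup E]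
    [NormedAddCommGroup G] [NormedAddCommGroup H] {Y : α → E} {g : α → G} (hY : AEStronglyMeasurable Y μ)
    (hg : ExpIntegrable μ Y g) {h : α → H} (hh : AEStronglyMeasurable h μ)
    (hle : ∀ ω, ‖h ω‖ ≤ ‖Y ω‖ * ‖g ω‖) : ExpIntegrable μ Y h := by
  refine ⟨hh, fun R => (hg.2 (R + 1)).mono' ?_ (.of_forall fun ω => ?_)⟩
  · exact (Real.continuous_exp.comp_aestronglyMeasurable (hY.norm.const_mul R)).mul hh.norm
  · rw [Real.norm_of_nonneg (by positivity), add_mul, one_mul, Real.exp_add, mul_assoc]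
    gcongr
    refine (hle ω).trans ?_
    gcongr
    linarith [Real.add_one_le_exp ‖Y ω‖]

variable {E G : Type*} [NormedAddCommGroup E] [InnerProductSpace ℝ E]
  [NormedAddCommGroup G] [NormedSpace ℝ G] {Y : α → E} {g : α → G}

theorem ExpIntegrable.aestronglyMeasurable_exp_smul (hY : AEStronglyMeasurable Y μ)
    (hg : ExpIntegrable μ Y g) (x : E) :
    AEStronglyMeasurable (fun ω => Real.exp ⟪x, Y ω⟫ • g ω) μ :=
  (Real.continuous_exp.comp_aestronglyMeasurable
    (aestronglyMeasurable_const.inner hY)).smul hg.1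

theorem norm_exp_inner_smul_le {x : E} {R : ℝ} (hx : ‖x‖ ≤ R) (y : E) (v : G) :
    ‖Real.exp ⟪x, y⟫ • v‖ ≤ Real.exp (R * ‖y‖) * ‖v‖ := by
  rw [norm_smul, Real.norm_of_nonneg (Real.exp_pos _).le]
  gcongr
  exact (real_inner_le_norm x y).trans (by gcongr)

theorem ExpIntegrable.integrable_exp_smul (hY : AEStronglyMeasurable Y μ)
    (hg : ExpIntegrable μ Y g) (x : E) :
    Integrable (fun ω => Real.exp ⟪x, Y ω⟫ • g ω) μ :=
  (hg.2 ‖x‖).mono' (hg.aestronglyMeasurable_exp_smul hY x)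
    (.of_forall fun ω => norm_exp_inner_smul_le le_rfl (Y ω) (g ω))

theorem ExpIntegrable.smulRight (hY : AEStronglyMeasurable Y μ) (hg : ExpIntegrable μ Y g) :
    ExpIntegrable μ Y (fun ω => (innerSL ℝ (Y ω)).smulRight (g ω)) := by
  refine hg.of_norm_le_norm_mul hY ?_ fun ω => ?_
  · have hc : Continuous fun p : E × G => (innerSL ℝ p.1).smulRight p.2 :=
      ((ContinuousLinearMap.smulRightL ℝ E G).continuous₂).comp
        (((innerSL ℝ).continuous.comp continuous_fst).prodMk continuous_snd)
    exact hc.comp_aestronglyMeasurable (hY.prodMk hg.1)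
  · rw [ContinuousLinearMap.norm_smulRight_apply, innerSL_apply_norm]

theorem ExpIntegrable.hasFDerivAt_integral (hY : AEStronglyMeasurable Y μ)
    (hg : ExpIntegrable μ Y g) (x : E) :
    HasFDerivAt (fun x => ∫ ω, Real.exp ⟪x, Y ω⟫ • g ω ∂μ)
      (∫ ω, Real.exp ⟪x, Y ω⟫ • (innerSL ℝ (Y ω)).smulRight (g ω) ∂μ) x := by
  have hg' := hg.smulRight hY
  refine hasFDerivAt_integral_of_dominated_of_fderiv_le
    (F' := fun x ω => Real.exp ⟪x, Y ω⟫ • (innerSL ℝ (Y ω)).smulRight (g ω))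
    (Metric.ball_mem_nhds x one_pos)
    (.of_forall (hg.aestronglyMeasurable_exp_smul hY)) (hg.integrable_exp_smul hY x)
    (hg'.aestronglyMeasurable_exp_smul hY x) (.of_forall fun ω z hz => ?_)
    (hg'.2 (‖x‖ + 1)) (.of_forall fun ω z _ => ?_)
  · refine norm_exp_inner_smul_le (x := z) ?_ (Y ω) ((innerSL ℝ (Y ω)).smulRight (g ω))
    have := norm_le_norm_add_norm_sub' z x
    rw [Metric.mem_ball, dist_eq_norm] at hz
    linarith
  · have h1 : HasFDerivAt (fun z : E => ⟪z, Y ω⟫) (innerSL ℝ (Y ω)) z := by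
      simpa [real_inner_comm] using (innerSL ℝ (Y ω)).hasFDerivAt (x := z)
    convert! ((Real.hasDerivAt_exp _).comp_hasFDerivAt z h1).smul_const (g ω) using 1
    ext v
    simp [mul_smul]

theorem ExpIntegrable.contDiff_integral {E G : Type u} [NormedAddCommGroup E]
    [InnerProductSpace ℝ E] [NormedAddCommGroup G] [NormedSpace ℝ G] {Y : α → E} {g : α → G}
    (hY : AEStronglyMeasurable Y μ) (hg : ExpIntegrable μ Y g) :
    ContDiff ℝ (⊤ : ℕ∞) (fun x => ∫ ω, Real.exp ⟪x, Y ω⟫ • g ω ∂μ) := by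
  have key (n : ℕ) : ∀ (G : Type u) [NormedAddCommGroup G] [NormedSpace ℝ G] (g : α → G),
      ExpIntegrable μ Y g → ContDiff ℝ n (fun x => ∫ ω, Real.exp ⟪x, Y ω⟫ • g ω ∂μ) := by
    induction n with
    | zero =>
      intro G _ _ g hg
      exact contDiff_zero.2 (continuous_iff_continuousAt.2 fun x =>
        (hg.hasFDerivAt_integral hY x).continuousAt)
    | succ n ih =>
      intro G _ _ g hg
      exact_mod_cast contDiff_succ_iff_hasFDerivAt.2
        ⟨_, ih _ _ (hg.smulRight hY), hg.hasFDerivAt_integral hY⟩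
  exact contDiff_infty.2 fun n => key n G g hg

theorem ExpIntegrable.smul_self {g : α → ℝ} (hY : AEStronglyMeasurable Y μ)
    (hg : ExpIntegrable μ Y g) : ExpIntegrable μ Y (fun ω => g ω • Y ω) :=
  hg.of_norm_le_norm_mul hY (hg.1.smul hY) fun ω => by rw [norm_smul, mul_comm]

theorem ExpIntegrable.hasGradientAt_integral [CompleteSpace E] {g : α → ℝ}
    (hY : AEStronglyMeasurable Y μ) (hg : ExpIntegrable μ Y g) (x : E) :
    HasGradientAt (fun x => ∫ ω, Real.exp ⟪x, Y ω⟫ * g ω ∂μ)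
      (∫ ω, Real.exp ⟪x, Y ω⟫ • g ω • Y ω ∂μ) x := by
  rw [hasGradientAt_iff_hasFDerivAt]
  convert! hg.hasFDerivAt_integral hY x using 1
  ext v
  rw [ContinuousLinearMap.integral_apply ((hg.smulRight hY).integrable_exp_smul hY x),
    InnerProductSpace.toDual_apply_apply, real_inner_comm,
    ← integral_inner ((hg.smul_self hY).integrable_exp_smul hY x)]
  refine integral_congr_ae (.of_forall fun ω => ?_)
  simp [inner_smul_right, real_inner_comm, mul_comm]

/-- The Hessian of a logarithmic Laplace transform is the covariance of the tilted measure. -/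
theorem ExpIntegrable.inner_fderiv_inv_smul_integral [CompleteSpace E] {g : α → ℝ}
    (hY : AEStronglyMeasurable Y μ) (hg : ExpIntegrable μ Y g) (x : E)
    (hx : ∫ ω, Real.exp ⟪x, Y ω⟫ * g ω ∂μ ≠ 0) :
    ∃ L : E →L[ℝ] E,
      HasFDerivAt (fun x => (∫ ω, Real.exp ⟪x, Y ω⟫ * g ω ∂μ)⁻¹ •
        ∫ ω, Real.exp ⟪x, Y ω⟫ • g ω • Y ω ∂μ) L x ∧
      ∀ u v, ⟪L u, v⟫ =
        (∫ ω, Real.exp ⟪x, Y ω⟫ * g ω ∂μ)⁻¹ *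
            ∫ ω, Real.exp ⟪x, Y ω⟫ * (g ω * (⟪Y ω, u⟫ * ⟪Y ω, v⟫)) ∂μ -
          ⟪(∫ ω, Real.exp ⟪x, Y ω⟫ * g ω ∂μ)⁻¹ • ∫ ω, Real.exp ⟪x, Y ω⟫ • g ω • Y ω ∂μ, u⟫ *
          ⟪(∫ ω, Real.exp ⟪x, Y ω⟫ * g ω ∂μ)⁻¹ • ∫ ω, Real.exp ⟪x, Y ω⟫ • g ω • Y ω ∂μ, v⟫ := by
  have hgY := hg.smul_self hY
  have hM := (hg.hasGradientAt_integral hY x).hasFDerivAt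
  refine ⟨_, ((hasDerivAt_inv hx).comp_hasFDerivAt x hM).smul
    (hgY.hasFDerivAt_integral hY x), fun u v => ?_⟩
  have hW : ⟪(∫ ω, Real.exp ⟪x, Y ω⟫ • (innerSL ℝ (Y ω)).smulRight (g ω • Y ω) ∂μ) u, v⟫ =
      ∫ ω, Real.exp ⟪x, Y ω⟫ * (g ω * (⟪Y ω, u⟫ * ⟪Y ω, v⟫)) ∂μ := by
    have hi := (hgY.smulRight hY).integrable_exp_smul hY x
    rw [ContinuousLinearMap.integral_apply hi, real_inner_comm,
      ← integral_inner (hi.apply_continuousLinearMap u)]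
    refine integral_congr_ae (.of_forall fun ω => ?_)
    simp only [FunLike.coe_smul, Pi.smul_apply, ContinuousLinearMap.smulRight_apply,
      innerSL_apply_apply, inner_smul_right, real_inner_comm (Y ω) v]
    ring
  simp only [Function.comp_apply, add_apply, smul_apply, ContinuousLinearMap.smulRight_apply,
    InnerProductSpace.toDual_apply_apply, inner_add_left, real_inner_smul_left, hW, smul_eq_mul]
  field_simp
  ring

end ExponentialIntegral

section OrnsteinUhlenbeck

variable {d : ℕ} {μ : Measure (Euc d)} {t : ℝ}

theorem one_sub_exp_neg_two_mul_pos (ht : 0 < t) : 0 < 1 - Real.exp (-2 * t) := by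
  rw [sub_pos, Real.exp_lt_one_iff]
  linarith

/-- The Gaussian kernel splits into a function of `x` and an exponentially tilted weight. -/
theorem exp_neg_norm_sub_smul_sq_div (a s : ℝ) (x y : Euc d) :
    Real.exp (-‖x - a • y‖ ^ 2 / (2 * s)) =
      Real.exp (-‖x‖ ^ 2 / (2 * s)) *
        (Real.exp ⟪x, (a / s) • y⟫ * Real.exp (-‖a • y‖ ^ 2 / (2 * s))) := by
  rw [← Real.exp_add, ← Real.exp_add, norm_sub_sq_real, real_inner_smul_right,
    real_inner_smul_right]
  congr 1
  ring

theorem integral_exp_neg_norm_sub_smul_sq_div (a s : ℝ) (x : Euc d) :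
    ∫ y, Real.exp (-‖x - a • y‖ ^ 2 / (2 * s)) ∂μ =
      Real.exp (-‖x‖ ^ 2 / (2 * s)) *
        ∫ y, Real.exp ⟪x, (a / s) • y⟫ * Real.exp (-‖a • y‖ ^ 2 / (2 * s)) ∂μ := by
  simp_rw [exp_neg_norm_sub_smul_sq_div, integral_const_mul]

theorem expIntegrable_gaussian [IsFiniteMeasure μ] (a : ℝ) {s : ℝ} (hs : 0 < s) :
    ExpIntegrable μ (fun y : Euc d => (a / s) • y)
      (fun y => Real.exp (-‖a • y‖ ^ 2 / (2 * s))) := by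
  refine ⟨by fun_prop, fun R => .of_bound (by fun_prop) (Real.exp (R ^ 2 / (2 * s)))
    (.of_forall fun y => ?_)⟩
  beta_reduce
  rw [Real.norm_of_nonneg (by positivity), Real.norm_of_nonneg (by positivity), ← Real.exp_add,
    Real.exp_le_exp, div_eq_inv_mul, mul_smul, norm_smul, norm_inv, Real.norm_of_nonneg hs.le]
  have h : 0 ≤ (‖a • y‖ - R) ^ 2 / (2 * s) := by positivity
  have h' : R ^ 2 / (2 * s) - (R * (s⁻¹ * ‖a • y‖) + -‖a • y‖ ^ 2 / (2 * s)) =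
      (‖a • y‖ - R) ^ 2 / (2 * s) := by
    field_simp
    ring
  linarith

theorem integrable_gaussian_kernel [IsFiniteMeasure μ] (a : ℝ) {s : ℝ} (hs : 0 < s) (x : Euc d) :
    Integrable (fun y => Real.exp (-‖x - a • y‖ ^ 2 / (2 * s))) μ := by
  simp_rw [exp_neg_norm_sub_smul_sq_div]
  exact ((expIntegrable_gaussian a hs).integrable_exp_smul (by fun_prop) x).const_mul _

theorem tiltedMeasure_eq_tilted [IsFiniteMeasure μ] [NeZero μ] (ht : 0 < t) (x : Euc d) :
    tiltedMeasure d μ t x = μ.tilted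
      fun y => -‖x - Real.exp (-t) • y‖ ^ 2 / (2 * (1 - Real.exp (-2 * t))) := by
  have hpos := integral_exp_pos
    (integrable_gaussian_kernel (μ := μ) (Real.exp (-t)) (one_sub_exp_neg_two_mul_pos ht) x)
  rw [tiltedMeasure, Measure.tilted, ← withDensity_smul _ (by fun_prop)]
  congr 1
  ext1 y
  rw [Pi.smul_apply, smul_eq_mul, ENNReal.ofReal_div_of_pos hpos, ENNReal.div_eq_inv_mul]

theorem integral_tiltedMeasure [IsFiniteMeasure μ] [NeZero μ] (ht : 0 < t) (x : Euc d)
    {G : Type*} [NormedAddCommGroup G] [NormedSpace ℝ G] (h : Euc d → G) :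
    ∫ y, h y ∂(tiltedMeasure d μ t x) =
      (∫ y, Real.exp ⟪x, (Real.exp (-t) / (1 - Real.exp (-2 * t))) • y⟫ *
          Real.exp (-‖Real.exp (-t) • y‖ ^ 2 / (2 * (1 - Real.exp (-2 * t)))) ∂μ)⁻¹ •
        ∫ y, Real.exp ⟪x, (Real.exp (-t) / (1 - Real.exp (-2 * t))) • y⟫ •
          Real.exp (-‖Real.exp (-t) • y‖ ^ 2 / (2 * (1 - Real.exp (-2 * t)))) • h y ∂μ := by
  rw [tiltedMeasure_eq_tilted ht, integral_tilted, integral_exp_neg_norm_sub_smul_sq_div,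
    ← integral_smul]
  refine integral_congr_ae (.of_forall fun y => ?_)
  simp only [exp_neg_norm_sub_smul_sq_div]
  rw [mul_div_mul_left _ _ (Real.exp_pos _).ne', smul_smul, smul_smul, div_eq_inv_mul,
    mul_assoc]

theorem ouDensity_eq (x : Euc d) :
    ouDensity d μ t x = (2 * π * (1 - Real.exp (-2 * t))) ^ (-(d : ℝ) / 2) *
      (Real.exp (-‖x‖ ^ 2 / (2 * (1 - Real.exp (-2 * t)))) *
        ∫ y, Real.exp ⟪x, (Real.exp (-t) / (1 - Real.exp (-2 * t))) • y⟫ *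
          Real.exp (-‖Real.exp (-t) • y‖ ^ 2 / (2 * (1 - Real.exp (-2 * t)))) ∂μ) := by
  rw [ouDensity, integral_exp_neg_norm_sub_smul_sq_div]

theorem contDiff_ouDensity [IsFiniteMeasure μ] (ht : 0 < t) :
    ContDiff ℝ (⊤ : ℕ∞) (ouDensity d μ t) := by
  rw [funext ouDensity_eq]
  have h := (expIntegrable_gaussian (μ := μ) (Real.exp (-t))
    (one_sub_exp_neg_two_mul_pos ht)).contDiff_integral (by fun_prop)
  exact contDiff_const.mul (((contDiff_norm_sq ℝ).neg.div_const _).exp.mul h)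

theorem ouDensity_pos [IsFiniteMeasure μ] [NeZero μ] (ht : 0 < t) (x : Euc d) :
    0 < ouDensity d μ t x := by
  have hs := one_sub_exp_neg_two_mul_pos ht
  exact mul_pos (Real.rpow_pos_of_pos (by positivity) _)
    (integral_exp_pos (integrable_gaussian_kernel _ hs x))

theorem integrable_norm_sq_tiltedMeasure [IsFiniteMeasure μ] [NeZero μ] (ht : 0 < t)
    (x : Euc d) : Integrable (fun y => ‖y‖ ^ 2) (tiltedMeasure d μ t x) := by
  have hs := one_sub_exp_neg_two_mul_pos ht
  rw [tiltedMeasure_eq_tilted ht, integrable_tilted_iff (integrable_gaussian_kernel _ hs x)]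
  have hY : AEStronglyMeasurable
    (fun y : Euc d => (Real.exp (-t) / (1 - Real.exp (-2 * t))) • y) μ := by fun_prop
  have h := ((((expIntegrable_gaussian (μ := μ) (Real.exp (-t)) hs).smul_self hY).smulRight
    hY).integrable_exp_smul hY x).norm
  refine (h.const_mul (Real.exp (-‖x‖ ^ 2 / (2 * (1 - Real.exp (-2 * t)))) /
    (Real.exp (-t) / (1 - Real.exp (-2 * t))) ^ 2)).congr (.of_forall fun y => ?_)
  simp only [exp_neg_norm_sub_smul_sq_div, norm_smul, ContinuousLinearMap.norm_smulRight_apply,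
    innerSL_apply_norm, Real.norm_eq_abs, Real.abs_exp, smul_eq_mul, abs_of_pos hs, abs_div]
  generalize 1 - Real.exp (-2 * t) = s at hs
  field_simp

theorem integral_exp_inner_mul_gaussian_pos [IsFiniteMeasure μ] [NeZero μ] (a : ℝ) {s : ℝ}
    (hs : 0 < s) (x : Euc d) :
    0 < ∫ y, Real.exp ⟪x, (a / s) • y⟫ * Real.exp (-‖a • y‖ ^ 2 / (2 * s)) ∂μ := by
  have h := integral_exp_pos (integrable_gaussian_kernel (μ := μ) a hs x)
  rw [integral_exp_neg_norm_sub_smul_sq_div] at h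
  exact pos_of_mul_pos_right h (Real.exp_pos _).le

theorem gradient_log_ouDensity [IsFiniteMeasure μ] [NeZero μ] (ht : 0 < t) (x : Euc d) :
    gradient (fun w => Real.log (ouDensity d μ t w)) x =
      -(1 / (1 - Real.exp (-2 * t))) • x +
      (∫ y, Real.exp ⟪x, (Real.exp (-t) / (1 - Real.exp (-2 * t))) • y⟫ *
          Real.exp (-‖Real.exp (-t) • y‖ ^ 2 / (2 * (1 - Real.exp (-2 * t)))) ∂μ)⁻¹ •
        ∫ y, Real.exp ⟪x, (Real.exp (-t) / (1 - Real.exp (-2 * t))) • y⟫ •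
          Real.exp (-‖Real.exp (-t) • y‖ ^ 2 / (2 * (1 - Real.exp (-2 * t)))) •
          (Real.exp (-t) / (1 - Real.exp (-2 * t))) • y ∂μ := by
  have hs := one_sub_exp_neg_two_mul_pos ht
  have hg := expIntegrable_gaussian (μ := μ) (Real.exp (-t)) hs
  have hM := integral_exp_inner_mul_gaussian_pos (μ := μ) (Real.exp (-t)) hs
  have hC : 0 < (2 * π * (1 - Real.exp (-2 * t))) ^ (-(d : ℝ) / 2) :=
    Real.rpow_pos_of_pos (by positivity) _
  simp_rw [ouDensity_eq, Real.log_mul hC.ne' (mul_pos (Real.exp_pos _) (hM _)).ne',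
    Real.log_mul (Real.exp_pos _).ne' (hM _).ne', Real.log_exp]
  apply HasGradientAt.gradient
  rw [hasGradientAt_iff_hasFDerivAt]
  have h1 := (hasStrictFDerivAt_norm_sq x).hasFDerivAt.neg.mul_const
    (2 * (1 - Real.exp (-2 * t)))⁻¹
  have h2 := (hg.hasGradientAt_integral (by fun_prop) x).hasFDerivAt.log (hM x).ne'
  convert! (h1.add h2).const_add (Real.log _) using 1
  ext v
  simp
  ring

theorem covariance_inner_eq_sub {E : Type*} [NormedAddCommGroup E] [InnerProductSpace ℝ E]
    [CompleteSpace E] [MeasurableSpace E] {ν : Measure E} [IsProbabilityMeasure ν]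
    (hν : MemLp id 2 ν) (u v : E) :
    ∫ y, ⟪y - ∫ z, z ∂ν, u⟫ * ⟪y - ∫ z, z ∂ν, v⟫ ∂ν =
      ∫ y, ⟪y, u⟫ * ⟪y, v⟫ ∂ν - ⟪∫ z, z ∂ν, u⟫ * ⟪∫ z, z ∂ν, v⟫ := by
  have hi : Integrable (fun z => z) ν := hν.integrable one_le_two
  have hL (w : E) : MemLp (fun y => ⟪y, w⟫) 2 ν := by
    simpa [real_inner_comm] using hν.inner_const (𝕜 := ℝ) w
  have hm (w : E) : ∫ y, ⟪y, w⟫ ∂ν = ⟪∫ z, z ∂ν, w⟫ := by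
    rw [real_inner_comm, ← integral_inner hi]
    simp_rw [real_inner_comm]
  have h := ProbabilityTheory.covariance_eq_sub (hL u) (hL v)
  simpa only [ProbabilityTheory.covariance, hm, ← inner_sub_left, Pi.mul_apply] using h

theorem inner_fderiv_gradient_log_ouDensity [IsProbabilityMeasure μ] (ht : 0 < t)
    (x u v : Euc d) :
    ⟪(fderiv ℝ (fun z => gradient (fun w => Real.log (ouDensity d μ t w)) z) x) u, v⟫ =
      -(1 / (1 - Real.exp (-2 * t))) * ⟪u, v⟫ +
        Real.exp (-2 * t) / (1 - Real.exp (-2 * t)) ^ 2 *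
          ∫ y, ⟪y - ∫ z, z ∂(tiltedMeasure d μ t x), u⟫ *
            ⟪y - ∫ z, z ∂(tiltedMeasure d μ t x), v⟫ ∂(tiltedMeasure d μ t x) := by
  have hs := one_sub_exp_neg_two_mul_pos ht
  have hp : IsProbabilityMeasure (tiltedMeasure d μ t x) := by
    rw [tiltedMeasure_eq_tilted ht]
    exact isProbabilityMeasure_tilted (integrable_gaussian_kernel _ hs x)
  have hL : MemLp id 2 (tiltedMeasure d μ t x) :=
    (memLp_two_iff_integrable_sq_norm aestronglyMeasurable_id).2
      (integrable_norm_sq_tiltedMeasure ht x)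
  obtain ⟨L, hL', hLuv⟩ := (expIntegrable_gaussian (μ := μ) (Real.exp (-t))
    hs).inner_fderiv_inv_smul_integral (by fun_prop) x
      (integral_exp_inner_mul_gaussian_pos (Real.exp (-t)) hs x).ne'
  have h1 := integral_tiltedMeasure (μ := μ) ht x
    fun y => (Real.exp (-t) / (1 - Real.exp (-2 * t))) • y
  have h2 := integral_tiltedMeasure (μ := μ) ht x
    fun y => ⟪(Real.exp (-t) / (1 - Real.exp (-2 * t))) • y, u⟫ *
      ⟪(Real.exp (-t) / (1 - Real.exp (-2 * t))) • y, v⟫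
  have h3 : Real.exp (-2 * t) = Real.exp (-t) ^ 2 := by
    rw [← Real.exp_nat_mul]
    congr 1
    push_cast
    ring
  have hD := ((hasFDerivAt_id x).const_smul (-(1 / (1 - Real.exp (-2 * t))))).add hL'
  have hD' : HasFDerivAt (fun z => gradient (fun w => Real.log (ouDensity d μ t w)) z) _ x :=
    hD.congr_of_eventuallyEq (.of_forall fun z => gradient_log_ouDensity ht z)
  simp only [smul_eq_mul] at h2
  rw [hD'.fderiv, add_apply, inner_add_left, hLuv, ← h1, ← h2, covariance_inner_eq_sub hL,
    integral_smul]
  simp_rw [real_inner_smul_left, mul_mul_mul_comm, integral_const_mul]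
  simp only [smul_apply, ContinuousLinearMap.id_apply, real_inner_smul_left]
  rw [show Real.exp (-2 * t) / (1 - Real.exp (-2 * t)) ^ 2 =
    Real.exp (-t) / (1 - Real.exp (-2 * t)) * (Real.exp (-t) / (1 - Real.exp (-2 * t))) by
      rw [div_mul_div_comm, ← sq, ← sq, h3]]
  ring

end OrnsteinUhlenbeck

/-- For any probability measure `μ` on `ℝ^d` and `t > 0`: `p_t` is smooth and
strictly positive, the tilted measure `ν_{t,x}` has finite second moment, and the Hessian of
`log p_t` satisfies `∇²log p_t(x) = −(1/(1−e^{−2t})) I_d + (e^{−2t}/(1−e^{−2t})²) Cov(ν_{t,x})`,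
stated through the associated bilinear forms. -/
theorem statement_4 (d : ℕ) (hd : 1 ≤ d)
    (μ : Measure (Euc d)) (hμ : IsProbabilityMeasure μ) (t : ℝ) (ht : 0 < t) :
    ContDiff ℝ (⊤ : ℕ∞) (ouDensity d μ t) ∧
    (∀ x : Euc d, 0 < ouDensity d μ t x) ∧
    (∀ x : Euc d, Integrable (fun y => ‖y‖ ^ 2) (tiltedMeasure d μ t x)) ∧
    (∀ x u v : Euc d,
      ⟪(fderiv ℝ (fun z => gradient (fun w => Real.log (ouDensity d μ t w)) z) x) u, v⟫ =
        -(1 / (1 - Real.exp (-2 * t))) * ⟪u, v⟫ +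
          Real.exp (-2 * t) / (1 - Real.exp (-2 * t)) ^ 2 *
            ∫ y, ⟪y - ∫ z, z ∂(tiltedMeasure d μ t x), u⟫ *
                  ⟪y - ∫ z, z ∂(tiltedMeasure d μ t x), v⟫ ∂(tiltedMeasure d μ t x)) := by
  exact ⟨contDiff_ouDensity ht, ouDensity_pos ht, integrable_norm_sq_tiltedMeasure ht,
    inner_fderiv_gradient_log_ouDensity ht⟩
end
end

section
/- There exist universal constants c ∈ (0,1) and C ≥ 1 such that the following holds. Let d ≥ 1, β ≥ 1, h ∈ (0,1] with βh ≤ c, and ϱ ∈ [1/2, 1). Let s₁ : ℝ^d → ℝ^d be β-Lipschitz and, for each u ∈ [0, ϱh], let s₂,u : ℝ^d → ℝ^d be β-Lipschitz, with (u,z) ↦ s₂,u(z) jointly measurable. Define the Markov kernel P on ℝ^d by letting P(x,·) be the law of e^{−h} x + 2(1−e^{−h}) s₂,τ(X⁺) + ξ, where τ has density u ↦ e^{u−h}/∫₀^{ϱh} e^{v−h} dv on [0, ϱh], X⁺ = e^{−τ} x + 2(1−e^{−τ}) s₁(x) + √(1−e^{−2τ}) Z₁, ξ = e^{τ−h} √(1−e^{−2τ})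 Z₁ + √(1−e^{−2(h−τ)}) Z₂, and τ, Z₁, Z₂ are independent with Z₁, Z₂ standard Gaussian vectors in ℝ^d. Then for all x, y ∈ ℝ^d, KL(P(x,·) ‖ P(y,·)) ≤ C·(‖x − y‖²/h)·log(e/(1−ϱ)). -/
open MeasureTheory Real
open scoped RealInnerProductSpace ENNReal Classical

noncomputable section

/-- Law of the truncated randomized midpoint time `τ`, with density
`u ↦ e^{u−h}/∫₀^{ϱh} e^{v−h} dv` on `[0, ϱh]`. -/
def midLaw (h ϱ : ℝ) : Measure ℝ :=
  (volume.restrict (Set.Icc 0 (ϱ * h))).withDensity fun u =>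
    ENNReal.ofReal (Real.exp (u - h) / ∫ v in Set.Icc (0 : ℝ) (ϱ * h), Real.exp (v - h))

/-- The Markov kernel `P(x, ·)`: one step of the truncated randomized midpoint discretization
with step size `h`, truncation `ϱ`, left-endpoint estimated relative score `s₁` and
midpoint estimated relative scores `s₂ u`. -/
def rmStep (d : ℕ) (s₁ : Euc d → Euc d) (s₂ : ℝ → Euc d → Euc d) (h ϱ : ℝ) (x : Euc d) :
    Measure (Euc d) :=
  Measure.map
    (fun q : ℝ × Euc d × Euc d =>
      Real.exp (-h) • x +
        (2 * (1 - Real.exp (-h))) •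
          s₂ q.1
            (Real.exp (-q.1) • x + (2 * (1 - Real.exp (-q.1))) • s₁ x +
              Real.sqrt (1 - Real.exp (-2 * q.1)) • q.2.1) +
        (Real.exp (q.1 - h) * Real.sqrt (1 - Real.exp (-2 * q.1))) • q.2.1 +
        Real.sqrt (1 - Real.exp (-2 * (h - q.1))) • q.2.2)
    ((midLaw h ϱ).prod ((stdGaussian d).prod (stdGaussian d)))

theorem integral_exp_neg_half_norm_sq (d : ℕ) :
    ∫ x : Euc d, Real.exp (-‖x‖ ^ 2 / 2) = (2 * π) ^ ((d : ℝ) / 2) := by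
  have h := GaussianFourier.integral_rexp_neg_mul_sq_norm (V := Euc d)
    (show (0 : ℝ) < 1 / 2 by norm_num)
  rw [show π / (1 / 2) = 2 * π by ring, finrank_euclideanSpace_fin] at h
  rw [← h]
  congr 1 with x
  ring_nf

theorem integrable_exp_neg_mul_norm_sq (d : ℕ) {b : ℝ} (hb : 0 < b) :
    Integrable fun x : Euc d => Real.exp (-b * ‖x‖ ^ 2) := by
  by_contra hn
  have h := GaussianFourier.integral_rexp_neg_mul_sq_norm (V := Euc d) hb
  rw [integral_undef hn] at h
  exact (Real.rpow_pos_of_pos (by positivity : 0 < π / b) _).ne h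

instance isProbabilityMeasure_stdGaussian (d : ℕ) : IsProbabilityMeasure (stdGaussian d) := by
  refine ⟨?_⟩
  have hi : Integrable fun x : Euc d => Real.exp (-‖x‖ ^ 2 / 2) :=
    (integrable_exp_neg_mul_norm_sq d (b := 1 / 2) (by norm_num)).congr
      (Filter.Eventually.of_forall fun x => by ring_nf)
  rw [stdGaussian, withDensity_apply _ MeasurableSet.univ, Measure.restrict_univ,
    ← ofReal_integral_eq_lintegral_ofReal (hi.const_mul _)
      (Filter.Eventually.of_forall fun x => by positivity),
    integral_const_mul, integral_exp_neg_half_norm_sq, ← Real.rpow_add (by positivity)]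
  simp [neg_div]

theorem integrable_norm_stdGaussian (d : ℕ) :
    Integrable (fun x : Euc d => ‖x‖) (stdGaussian d) := by
  rw [stdGaussian, integrable_withDensity_iff (by fun_prop) (by simp)]
  refine ((integrable_exp_neg_mul_norm_sq d (b := 1 / 4) (by norm_num)).const_mul
    ((2 * π) ^ (-(d : ℝ) / 2))).mono' (by fun_prop) (Filter.Eventually.of_forall fun x => ?_)
  rw [ENNReal.toReal_ofReal (by positivity), Real.norm_of_nonneg (by positivity)]
  have h1 : ‖x‖ ≤ Real.exp (‖x‖ ^ 2 / 4) := by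
    nlinarith [Real.add_one_le_exp (‖x‖ ^ 2 / 4), sq_nonneg (‖x‖ - 2)]
  have h2 : Real.exp (-(1 / 4) * ‖x‖ ^ 2)
      = Real.exp (‖x‖ ^ 2 / 4) * Real.exp (-‖x‖ ^ 2 / 2) := by
    rw [← Real.exp_add]; ring_nf
  rw [h2, mul_left_comm]
  gcongr

theorem integral_inner_stdGaussian (d : ℕ) (v : Euc d) :
    ∫ z, ⟪v, z⟫ ∂(stdGaussian d) = 0 := by
  rw [stdGaussian, integral_withDensity_eq_integral_toReal_smul (by fun_prop) (by simp)]
  have h := integral_neg_eq_self (μ := (volume : Measure (Euc d))) fun x : Euc d =>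
    (ENNReal.ofReal ((2 * π) ^ (-(d : ℝ) / 2) * Real.exp (-‖x‖ ^ 2 / 2))).toReal • ⟪v, x⟫
  simp only [norm_neg, inner_neg_right, smul_neg, integral_neg] at h
  linarith

/-- The law of the sheared map `(ω, z) ↦ (ω, z + δ ω)` under a product with a standard Gaussian. -/
theorem map_shear_prod_stdGaussian {Ω : Type*} [MeasurableSpace Ω] (μ : Measure Ω) [SFinite μ]
    (d : ℕ) {δ : Ω → Euc d} (hδ : Measurable δ) :
    Measure.map (fun q : Ω × Euc d => (q.1, q.2 + δ q.1)) (μ.prod (stdGaussian d)) =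
      (μ.prod (stdGaussian d)).withDensity fun q =>
        ENNReal.ofReal (Real.exp (⟪δ q.1, q.2⟫ - ‖δ q.1‖ ^ 2 / 2)) := by
  have hS : Measurable fun q : Ω × Euc d => (q.1, q.2 + δ q.1) := by fun_prop
  refine Measure.ext_of_lintegral _ fun g hg => ?_
  rw [lintegral_map hg hS, lintegral_withDensity_eq_lintegral_mul _ (by fun_prop) hg,
    lintegral_prod _ (by fun_prop), lintegral_prod _ (by fun_prop)]
  refine lintegral_congr fun ω => ?_
  simp only [Pi.mul_apply]
  rw [stdGaussian, lintegral_withDensity_eq_lintegral_mul _ (by fun_prop) (by fun_prop),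
    lintegral_withDensity_eq_lintegral_mul _ (by fun_prop) (by fun_prop)]
  simp only [Pi.mul_apply]
  symm
  rw [← lintegral_add_right_eq_self _ (δ ω)]
  refine lintegral_congr fun z => ?_
  rw [← mul_assoc, ← ENNReal.ofReal_mul (by positivity), mul_assoc, ← Real.exp_add]
  congr 4
  rw [norm_add_sq_real, inner_add_right, real_inner_self_eq_norm_sq, real_inner_comm]
  ring

/-- Data processing combined with the Gibbs variational inequality: if the map `S` pushes `μ`
forward to `exp f · μ`, then the laws of `T ∘ S` and `T` under `μ` have divergence at most
`∫ f ∘ S ∂μ`. -/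
theorem KLdiv_map_comp_le {α F : Type*} [MeasurableSpace α] [MeasurableSpace F]
    (μ : Measure α) [IsProbabilityMeasure μ] {S : α → α} {f : α → ℝ} {T : α → F}
    (hS : Measurable S) (hf : Measurable f) (hT : Measurable T)
    (hμ : Measure.map S μ = μ.withDensity fun q => ENNReal.ofReal (Real.exp (f q)))
    (hfS : Integrable (fun q => f (S q)) μ) :
    KLdiv (Measure.map (fun q => T (S q)) μ) (Measure.map T μ) ≤
      ENNReal.ofReal (∫ q, f (S q) ∂μ) := by
  have hTS : Measurable fun q => T (S q) := hT.comp hS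
  have hmap : Measure.map (fun q => T (S q)) μ = Measure.map T (Measure.map S μ) :=
    (Measure.map_map hT hS).symm
  set ρ := Measure.map (fun q => T (S q)) μ with hρ
  set ν := Measure.map T μ with hν
  have : IsProbabilityMeasure ρ := Measure.isProbabilityMeasure_map hTS.aemeasurable
  have : IsProbabilityMeasure ν := Measure.isProbabilityMeasure_map hT.aemeasurable
  have hac : ρ ≪ ν := by
    rw [hmap, hμ]
    exact (withDensity_absolutelyContinuous _ _).map hT
  set p := ρ.rnDeriv ν
  have hpm : Measurable p := Measure.measurable_rnDeriv _ _
  rw [KLdiv, if_pos hac]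
  by_cases hL : Integrable (fun x => Real.log (p x).toReal) ρ
  swap
  · rw [integral_undef hL]; simp
  refine ENNReal.ofReal_le_ofReal ?_
  have hLm : Measurable fun x => Real.log (p x).toReal := by fun_prop
  have hL' : Integrable (fun q => Real.log (p (T (S q))).toReal) μ :=
    (integrable_map_measure hLm.aestronglyMeasurable hTS.aemeasurable).1 hL
  rw [hρ, integral_map hTS.aemeasurable hLm.aestronglyMeasurable]
  have hpos : ∀ᵐ q ∂μ, 0 < p (T (S q)) :=
    ae_of_ae_map hTS.aemeasurable (Measure.rnDeriv_pos hac)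
  have hfin : ∀ᵐ q ∂μ, p (T (S q)) < ∞ :=
    ae_of_ae_map hTS.aemeasurable (hac.ae_le (Measure.rnDeriv_lt_top ρ ν))
  have hlint : ∫⁻ q, p (T (S q)) * ENNReal.ofReal (Real.exp (-f (S q))) ∂μ ≤ 1 := by
    have hg : Measurable fun q => p (T q) * ENNReal.ofReal (Real.exp (-f q)) := by fun_prop
    rw [← lintegral_map hg hS, hμ, lintegral_withDensity_eq_lintegral_mul _ (by fun_prop) hg]
    calc _ = ∫⁻ q, p (T q) ∂μ := by
          refine lintegral_congr fun q => ?_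
          rw [Pi.mul_apply, mul_left_comm, ← ENNReal.ofReal_mul (by positivity), ← Real.exp_add]
          simp
      _ = ∫⁻ x, p x ∂ν := by rw [hν, lintegral_map hpm hT]
      _ ≤ ρ Set.univ := Measure.lintegral_rnDeriv_le
      _ = 1 := measure_univ
  set r : α → ℝ := fun q => (p (T (S q)) * ENNReal.ofReal (Real.exp (-f (S q)))).toReal with hr
  have hrm : Measurable fun q => p (T (S q)) * ENNReal.ofReal (Real.exp (-f (S q))) := by
    fun_prop
  have hri : Integrable r μ :=
    integrable_toReal_of_lintegral_ne_top hrm.aemeasurable (hlint.trans_lt ENNReal.one_lt_top).ne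
  have hri1 : Integrable (fun q => r q - 1) μ := hri.sub (integrable_const _)
  have hr1 : ∫ q, r q ∂μ ≤ 1 := by
    rw [hr, integral_toReal hrm.aemeasurable (ae_lt_top hrm (hlint.trans_lt ENNReal.one_lt_top).ne)]
    exact ENNReal.toReal_le_of_le_ofReal zero_le_one (by simpa using hlint)
  calc ∫ q, Real.log (p (T (S q))).toReal ∂μ
      ≤ ∫ q, (f (S q) + (r q - 1)) ∂μ := by
        refine integral_mono_ae hL' (hfS.add hri1) ?_
        filter_upwards [hpos, hfin] with q h0 h1
        have h2 : 0 < (p (T (S q))).toReal := ENNReal.toReal_pos h0.ne' h1.ne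
        have h3 : r q = (p (T (S q))).toReal * Real.exp (-f (S q)) := by
          simp only [hr]
          rw [ENNReal.toReal_mul, ENNReal.toReal_ofReal (Real.exp_pos _).le]
        have h4 := Real.log_le_sub_one_of_pos (x := r q) (by rw [h3]; positivity)
        have h5 : Real.log (r q) = Real.log (p (T (S q))).toReal - f (S q) := by
          rw [h3, Real.log_mul h2.ne' (Real.exp_pos _).ne', Real.log_exp]
          ring
        linarith
    _ = ∫ q, f (S q) ∂μ + (∫ q, r q ∂μ - 1) := by
        rw [integral_add hfS hri1, integral_sub hri (integrable_const _)]
        simp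
    _ ≤ ∫ q, f (S q) ∂μ := by linarith

/-- Shifting the Gaussian noise by a square-integrable amount `δ` that is independent of it costs at
most `E‖δ‖² / 2` in divergence, after any post-processing `T`. -/
theorem KLdiv_map_shear_le {Ω F : Type*} [MeasurableSpace Ω] [MeasurableSpace F]
    (μ : Measure Ω) [IsProbabilityMeasure μ] (d : ℕ) {δ : Ω → Euc d} {T : Ω × Euc d → F}
    (hδ : Measurable δ) (hT : Measurable T) (hδi : Integrable (fun ω => ‖δ ω‖ ^ 2) μ) :
    KLdiv (Measure.map (fun q : Ω × Euc d => T (q.1, q.2 + δ q.1)) (μ.prod (stdGaussian d)))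
        (Measure.map T (μ.prod (stdGaussian d))) ≤
      ENNReal.ofReal (∫ ω, ‖δ ω‖ ^ 2 / 2 ∂μ) := by
  have hδ1 : Integrable (fun ω => ‖δ ω‖) μ := by
    refine ((hδi.add (integrable_const 1))).mono' (by fun_prop)
      (Filter.Eventually.of_forall fun ω => ?_)
    simp only [norm_norm, Pi.add_apply]
    nlinarith [sq_nonneg (‖δ ω‖ - 1), norm_nonneg (δ ω)]
  have hin : Integrable (fun q : Ω × Euc d => ⟪δ q.1, q.2⟫) (μ.prod (stdGaussian d)) := by
    refine (hδ1.mul_prod (integrable_norm_stdGaussian d)).mono' (by fun_prop)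
      (Filter.Eventually.of_forall fun q => ?_)
    exact norm_inner_le_norm _ _
  have hsq : Integrable (fun q : Ω × Euc d => ‖δ q.1‖ ^ 2 / 2) (μ.prod (stdGaussian d)) :=
    (hδi.div_const 2).comp_fst _
  have hfS : ∀ q : Ω × Euc d, ⟪δ q.1, q.2 + δ q.1⟫ - ‖δ q.1‖ ^ 2 / 2
      = ⟪δ q.1, q.2⟫ + ‖δ q.1‖ ^ 2 / 2 := fun q => by
    rw [inner_add_right, real_inner_self_eq_norm_sq]; ring
  refine (KLdiv_map_comp_le (μ.prod (stdGaussian d)) (S := fun q => (q.1, q.2 + δ q.1))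
    (f := fun q => ⟪δ q.1, q.2⟫ - ‖δ q.1‖ ^ 2 / 2) (by fun_prop) (by fun_prop) hT
    (map_shear_prod_stdGaussian μ d hδ) ?_).trans_eq ?_
  · simp only [hfS]
    exact hin.add hsq
  · simp only [hfS]
    rw [integral_add hin hsq, integral_prod _ hin, integral_fun_fst (fun ω => ‖δ ω‖ ^ 2 / 2)]
    simp [integral_inner_stdGaussian]

theorem exp_div_setIntegral_nonneg (h ϱ u : ℝ) :
    0 ≤ Real.exp (u - h) / ∫ v in Set.Icc (0 : ℝ) (ϱ * h), Real.exp (v - h) :=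
  div_nonneg (Real.exp_pos _).le (integral_nonneg fun _ => (Real.exp_pos _).le)

theorem integrableOn_exp_sub (h ϱ : ℝ) :
    IntegrableOn (fun v : ℝ => Real.exp (v - h)) (Set.Icc 0 (ϱ * h)) :=
  (by fun_prop : Continuous fun v : ℝ => Real.exp (v - h)).continuousOn.integrableOn_Icc

theorem le_setIntegral_exp_sub {h ϱ : ℝ} (hh : 0 < h) (hh1 : h ≤ 1) (hϱ : 1 / 2 ≤ ϱ) :
    Real.exp (-1) * (h / 2) ≤ ∫ v in Set.Icc (0 : ℝ) (ϱ * h), Real.exp (v - h) := by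
  have hϱh : h / 2 ≤ ϱ * h := by nlinarith
  calc Real.exp (-1) * (h / 2) ≤ Real.exp (-1) * (ϱ * h) := by gcongr
    _ = ∫ v in Set.Icc (0 : ℝ) (ϱ * h), Real.exp (-1) := by
        rw [setIntegral_const, Real.volume_real_Icc_of_le (by linarith), smul_eq_mul]
        ring
    _ ≤ _ := by
        refine setIntegral_mono_on (integrable_const _) (integrableOn_exp_sub h ϱ)
          measurableSet_Icc fun v hv => ?_
        exact Real.exp_le_exp.2 (by linarith [hv.1])

theorem isProbabilityMeasure_midLaw {h ϱ : ℝ} (hh : 0 < h) (hh1 : h ≤ 1) (hϱ : 1 / 2 ≤ ϱ) :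
    IsProbabilityMeasure (midLaw h ϱ) := by
  have hpos : 0 < ∫ v in Set.Icc (0 : ℝ) (ϱ * h), Real.exp (v - h) :=
    lt_of_lt_of_le (by positivity) (le_setIntegral_exp_sub hh hh1 hϱ)
  refine ⟨?_⟩
  rw [midLaw, withDensity_apply _ MeasurableSet.univ, Measure.restrict_univ,
    ← ofReal_integral_eq_lintegral_ofReal ((integrableOn_exp_sub h ϱ).div_const _)
      (Filter.Eventually.of_forall fun u => exp_div_setIntegral_nonneg h ϱ u),
    integral_div, div_self hpos.ne', ENNReal.ofReal_one]

theorem ae_midLaw_mem_Icc (h ϱ : ℝ) : ∀ᵐ u ∂(midLaw h ϱ), u ∈ Set.Icc 0 (ϱ * h) :=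
  (withDensity_absolutelyContinuous _ _).ae_le (ae_restrict_mem measurableSet_Icc)

theorem integrableOn_inv_sub {h ϱ : ℝ} (hh : 0 < h) (hϱ1 : ϱ < 1) :
    IntegrableOn (fun u : ℝ => (h - u)⁻¹) (Set.Icc 0 (ϱ * h)) := by
  refine ContinuousOn.integrableOn_Icc (ContinuousOn.inv₀ (by fun_prop) fun u hu => ?_)
  have : ϱ * h < h := by nlinarith
  linarith [hu.2]

theorem setIntegral_inv_sub {h ϱ : ℝ} (hh : 0 < h) (hϱ : 1 / 2 ≤ ϱ) (hϱ1 : ϱ < 1) :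
    ∫ u in Set.Icc 0 (ϱ * h), (h - u)⁻¹ = -Real.log (1 - ϱ) := by
  have hlt : ϱ * h < h := by nlinarith
  rw [integral_Icc_eq_integral_Ioc, ← intervalIntegral.integral_of_le (by positivity),
    intervalIntegral.integral_comp_sub_left (fun x : ℝ => x⁻¹), sub_zero,
    integral_inv_of_pos (by linarith) hh, ← Real.log_inv]
  congr 1
  have : 1 - ϱ ≠ 0 := by linarith
  have : h - ϱ * h ≠ 0 := by linarith
  field_simp

theorem integral_inv_sub_midLaw_le {h ϱ : ℝ} (hh : 0 < h) (hh1 : h ≤ 1) (hϱ : 1 / 2 ≤ ϱ)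
    (hϱ1 : ϱ < 1) :
    Integrable (fun u => (h - u)⁻¹) (midLaw h ϱ) ∧
      ∫ u, (h - u)⁻¹ ∂(midLaw h ϱ) ≤ 6 / h * -Real.log (1 - ϱ) := by
  have hlt : ϱ * h < h := by nlinarith
  have hI := le_setIntegral_exp_sub hh hh1 hϱ
  have hbound : ∀ u ∈ Set.Icc 0 (ϱ * h),
      (Real.exp (u - h) / ∫ v in Set.Icc (0 : ℝ) (ϱ * h), Real.exp (v - h)) * (h - u)⁻¹ ≤
        6 / h * (h - u)⁻¹ := by
    intro u hu
    have hsub : 0 < h - u := by linarith [hu.2]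
    refine mul_le_mul_of_nonneg_right ?_ (by positivity)
    have he : Real.exp 1 ≤ 3 := by linarith [Real.exp_one_lt_d9]
    calc _ ≤ 1 / (Real.exp (-1) * (h / 2)) := by
          refine div_le_div₀ zero_le_one (Real.exp_le_one_iff.2 (by linarith)) (by positivity) hI
      _ = Real.exp 1 * 2 / h := by
          rw [Real.exp_neg]
          field_simp
      _ ≤ 6 / h := by gcongr; linarith
  have hInt : IntegrableOn (fun u =>
      (Real.exp (u - h) / ∫ v in Set.Icc (0 : ℝ) (ϱ * h), Real.exp (v - h)) * (h - u)⁻¹)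
      (Set.Icc 0 (ϱ * h)) := by
    refine ((integrableOn_inv_sub hh hϱ1).const_mul (6 / h)).mono' (by fun_prop) ?_
    refine (ae_restrict_mem measurableSet_Icc).mono fun u hu => ?_
    have hsub : 0 < h - u := by linarith [hu.2]
    rw [Real.norm_of_nonneg (mul_nonneg (exp_div_setIntegral_nonneg h ϱ u) (by positivity))]
    exact hbound u hu
  constructor
  · rw [midLaw, integrable_withDensity_iff_integrable_smul' (by fun_prop) (by simp)]
    simp only [ENNReal.toReal_ofReal (exp_div_setIntegral_nonneg h ϱ _), smul_eq_mul]
    exact hInt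
  · rw [midLaw, integral_withDensity_eq_integral_toReal_smul (by fun_prop) (by simp),
      ← setIntegral_inv_sub hh hϱ hϱ1, ← integral_const_mul]
    simp only [ENNReal.toReal_ofReal (exp_div_setIntegral_nonneg h ϱ _), smul_eq_mul]
    exact setIntegral_mono_on hInt ((integrableOn_inv_sub hh hϱ1).const_mul _)
      measurableSet_Icc hbound

theorem two_thirds_mul_le_one_sub_exp {t : ℝ} (ht : 0 ≤ t) (ht1 : t ≤ 1) :
    2 / 3 * t ≤ 1 - Real.exp (-2 * t) := by
  have h1 : Real.exp (-2 * t) * Real.exp (2 * t) = 1 := by rw [← Real.exp_add]; simp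
  have h2 : 0 ≤ Real.exp (-2 * t) * (Real.exp (2 * t) - (2 * t + 1)) :=
    mul_nonneg (Real.exp_pos _).le (by linarith [Real.add_one_le_exp (2 * t)])
  nlinarith [Real.exp_pos (-2 * t)]

/-- The conditional mean of the midpoint step from `x`, given `τ = u` and up to the part of the
noise `Z₁` that is added directly. -/
def midDrift (d : ℕ) (s₁ : Euc d → Euc d) (s₂ : ℝ → Euc d → Euc d) (h : ℝ) (x : Euc d)
    (q : ℝ × Euc d) : Euc d :=
  Real.exp (-h) • x +
    (2 * (1 - Real.exp (-h))) •
      s₂ q.1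
        (Real.exp (-q.1) • x + (2 * (1 - Real.exp (-q.1))) • s₁ x +
          Real.sqrt (1 - Real.exp (-2 * q.1)) • q.2)

theorem measurable_midDrift (d : ℕ) (s₁ : Euc d → Euc d) {s₂ : ℝ → Euc d → Euc d} (h : ℝ)
    (x : Euc d) (hs₂ : Measurable (Function.uncurry s₂)) :
    Measurable (midDrift d s₁ s₂ h x) := by
  have : Measurable fun q : ℝ × Euc d => Function.uncurry s₂ (q.1,
      Real.exp (-q.1) • x + (2 * (1 - Real.exp (-q.1))) • s₁ x +
        Real.sqrt (1 - Real.exp (-2 * q.1)) • q.2) := hs₂.comp (by fun_prop)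
  exact (this.const_smul (2 * (1 - Real.exp (-h)))).const_add _

theorem norm_midDrift_sub_le {d : ℕ} {s₁ : Euc d → Euc d} {s₂ : ℝ → Euc d → Euc d} {β h u : ℝ}
    (hβ : 0 ≤ β) (hβh : β * h ≤ 1 / 2) (hu : 0 ≤ u) (huh : u ≤ h)
    (hs₁ : ∀ x y, ‖s₁ x - s₁ y‖ ≤ β * ‖x - y‖)
    (hs₂ : ∀ x y, ‖s₂ u x - s₂ u y‖ ≤ β * ‖x - y‖) (x y z : Euc d) :
    ‖midDrift d s₁ s₂ h x (u, z) - midDrift d s₁ s₂ h y (u, z)‖ ≤ 3 * ‖x - y‖ := by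
  have hexp : ∀ t : ℝ, 0 ≤ t → 0 ≤ 1 - Real.exp (-t) ∧ 1 - Real.exp (-t) ≤ t := fun t ht =>
    ⟨by linarith [Real.exp_le_one_iff.2 (neg_nonpos.2 ht)], by
      linarith [Real.add_one_le_exp (-t)]⟩
  have step : ∀ (t : ℝ) (a b : Euc d), 0 ≤ t → ‖Real.exp (-t) • a + (2 * (1 - Real.exp (-t))) • b‖
      ≤ ‖a‖ + 2 * t * ‖b‖ := by
    intro t a b ht
    refine (norm_add_le _ _).trans ?_
    rw [norm_smul, norm_smul, Real.norm_of_nonneg (Real.exp_pos _).le,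
      Real.norm_of_nonneg (by linarith [hexp t ht])]
    have h1 : Real.exp (-t) ≤ 1 := by linarith [hexp t ht]
    have h2 := mul_le_mul_of_nonneg_right h1 (norm_nonneg a)
    have h3 := mul_le_mul_of_nonneg_right (hexp t ht).2 (norm_nonneg b)
    nlinarith
  set X := Real.exp (-u) • x + (2 * (1 - Real.exp (-u))) • s₁ x +
    Real.sqrt (1 - Real.exp (-2 * u)) • z with hX
  set Y := Real.exp (-u) • y + (2 * (1 - Real.exp (-u))) • s₁ y +
    Real.sqrt (1 - Real.exp (-2 * u)) • z with hY
  have hβu : β * u ≤ 1 / 2 := (mul_le_mul_of_nonneg_left huh hβ).trans hβh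
  have hXY : ‖X - Y‖ ≤ 2 * ‖x - y‖ := by
    have e : X - Y = Real.exp (-u) • (x - y) + (2 * (1 - Real.exp (-u))) • (s₁ x - s₁ y) := by
      rw [hX, hY]; module
    rw [e]
    refine (step u _ _ hu).trans ?_
    have h1 := mul_le_mul_of_nonneg_left (hs₁ x y) hu
    have h2 := mul_le_mul_of_nonneg_right hβu (norm_nonneg (x - y))
    nlinarith
  have e : midDrift d s₁ s₂ h x (u, z) - midDrift d s₁ s₂ h y (u, z)
      = Real.exp (-h) • (x - y) + (2 * (1 - Real.exp (-h))) • (s₂ u X - s₂ u Y) := by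
    simp only [midDrift]; module
  rw [e]
  have hh : 0 ≤ h := hu.trans huh
  refine (step h _ _ hh).trans ?_
  have h1 := mul_le_mul_of_nonneg_left (hs₂ X Y) hh
  have h2 := mul_le_mul_of_nonneg_right hβh (norm_nonneg (X - Y))
  nlinarith

/-- The midpoint step as the image of a product of a base law and the final Gaussian noise. -/
theorem rmStep_eq_map (d : ℕ) (s₁ : Euc d → Euc d) {s₂ : ℝ → Euc d → Euc d} (h ϱ : ℝ) (x : Euc d)
    (hs₂ : Measurable (Function.uncurry s₂)) :
    rmStep d s₁ s₂ h ϱ x =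
      Measure.map
        (fun q : (ℝ × Euc d) × Euc d =>
          midDrift d s₁ s₂ h x q.1 +
            (Real.exp (q.1.1 - h) * Real.sqrt (1 - Real.exp (-2 * q.1.1))) • q.1.2 +
            Real.sqrt (1 - Real.exp (-2 * (h - q.1.1))) • q.2)
        (((midLaw h ϱ).prod (stdGaussian d)).prod (stdGaussian d)) := by
  have hsf : SFinite (midLaw h ϱ) := by unfold midLaw; infer_instance
  have hm := measurable_midDrift d s₁ h x hs₂
  have hm' : Measurable fun q : ℝ × Euc d × Euc d => midDrift d s₁ s₂ h x (q.1, q.2.1) :=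
    hm.comp (by fun_prop)
  rw [rmStep, ← Measure.prodAssoc_prod, Measure.map_map _ MeasurableEquiv.prodAssoc.measurable]
  · rfl
  · exact (hm'.add (by fun_prop)).add (by fun_prop)

/-- KL regularity of one truncated randomized midpoint step. There are
universal constants `c ∈ (0,1)`, `C ≥ 1` such that for `β ≥ 1`, `h ∈ (0,1]` with `βh ≤ c`,
`ϱ ∈ [1/2, 1)`, and β-Lipschitz scores, `KL(P(x,·) ‖ P(y,·)) ≤ C (‖x−y‖²/h) log(e/(1−ϱ))`. -/
theorem statement_8 :
    ∃ c C : ℝ, c ∈ Set.Ioo (0 : ℝ) 1 ∧ 1 ≤ C ∧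
      ∀ (d : ℕ), 1 ≤ d →
        ∀ (β h ϱ : ℝ), 1 ≤ β → 0 < h → h ≤ 1 → β * h ≤ c →
          ϱ ∈ Set.Ico (1 / 2 : ℝ) 1 →
          ∀ (s₁ : Euc d → Euc d) (s₂ : ℝ → Euc d → Euc d),
            (∀ x y, ‖s₁ x - s₁ y‖ ≤ β * ‖x - y‖) →
            (∀ u ∈ Set.Icc 0 (ϱ * h), ∀ x y, ‖s₂ u x - s₂ u y‖ ≤ β * ‖x - y‖) →
            Measurable (Function.uncurry s₂) →
            ∀ x y : Euc d,
              KLdiv (rmStep d s₁ s₂ h ϱ x) (rmStep d s₁ s₂ h ϱ y) ≤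
                ENNReal.ofReal
                  (C * (‖x - y‖ ^ 2 / h) * Real.log (Real.exp 1 / (1 - ϱ))) := by
  refine ⟨1 / 2, 41, ⟨by norm_num, by norm_num⟩, by norm_num, ?_⟩
  intro d _ β h ϱ hβ hh hh1 hβh ⟨hϱ, hϱ1⟩ s₁ s₂ hs₁ hs₂ hm x y
  have hlt : ϱ * h < h := by nlinarith
  have := isProbabilityMeasure_midLaw hh hh1 hϱ
  set μ := (midLaw h ϱ).prod (stdGaussian d) with hμ
  have hmx := measurable_midDrift d s₁ h x hm
  have hmy := measurable_midDrift d s₁ h y hm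
  let σ : ℝ → ℝ := fun u => Real.sqrt (1 - Real.exp (-2 * (h - u)))
  have hσm : Measurable σ := by fun_prop
  let δ : ℝ × Euc d → Euc d := fun ω =>
    (σ ω.1)⁻¹ • (midDrift d s₁ s₂ h x ω - midDrift d s₁ s₂ h y ω)
  have hδ : Measurable δ := by fun_prop
  let T : (ℝ × Euc d) × Euc d → Euc d := fun q =>
    midDrift d s₁ s₂ h y q.1 +
      (Real.exp (q.1.1 - h) * Real.sqrt (1 - Real.exp (-2 * q.1.1))) • q.1.2 + σ q.1.1 • q.2
  have hT : Measurable T := by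
    have : Measurable fun q : (ℝ × Euc d) × Euc d => midDrift d s₁ s₂ h y q.1 :=
      hmy.comp measurable_fst
    exact (this.add (by fun_prop)).add (by fun_prop)
  have hmem : ∀ᵐ ω ∂μ, ω.1 ∈ Set.Icc 0 (ϱ * h) :=
    Measure.quasiMeasurePreserving_fst.ae (ae_midLaw_mem_Icc h ϱ)
  have hσ : ∀ u ∈ Set.Icc 0 (ϱ * h), 0 < h - u ∧ 2 / 3 * (h - u) ≤ 1 - Real.exp (-2 * (h - u)) :=
    fun u hu => ⟨by linarith [hu.2], two_thirds_mul_le_one_sub_exp (by linarith [hu.2])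
      (by linarith [hu.1])⟩
  have hx : rmStep d s₁ s₂ h ϱ x =
      Measure.map (fun q : (ℝ × Euc d) × Euc d => T (q.1, q.2 + δ q.1))
        (μ.prod (stdGaussian d)) := by
    rw [rmStep_eq_map d s₁ h ϱ x hm]
    refine Measure.map_congr ?_
    filter_upwards [Measure.quasiMeasurePreserving_fst.ae hmem] with q hq
    have hpos : 0 < σ q.1.1 := Real.sqrt_pos.2 (by linarith [hσ _ hq])
    change _ + Real.sqrt (1 - Real.exp (-2 * (h - q.1.1))) • q.2 = _ + σ q.1.1 • (q.2 + δ q.1)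
    simp only [δ]
    rw [smul_add, smul_inv_smul₀ hpos.ne']
    simp only [σ]
    module
  have hδle : ∀ᵐ ω ∂μ, ‖δ ω‖ ^ 2 ≤ 27 / 2 * ‖x - y‖ ^ 2 * (h - ω.1)⁻¹ := by
    filter_upwards [hmem] with ω hω
    obtain ⟨h1, h2⟩ := hσ _ hω
    have h3 := norm_midDrift_sub_le (z := ω.2) (by linarith) hβh hω.1 (by linarith [hω.2]) hs₁
      (hs₂ _ hω) x y
    have h4 : 0 < 1 - Real.exp (-2 * (h - ω.1)) := by linarith
    simp only [δ, σ]
    rw [norm_smul, mul_pow, norm_inv, Real.norm_of_nonneg (Real.sqrt_nonneg _), inv_pow,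
      Real.sq_sqrt h4.le]
    calc _ ≤ (2 / 3 * (h - ω.1))⁻¹ * (3 * ‖x - y‖) ^ 2 := by gcongr
      _ = _ := by field_simp; ring
  obtain ⟨hi, hle⟩ := integral_inv_sub_midLaw_le hh hh1 hϱ hϱ1
  have hi' : Integrable (fun ω : ℝ × Euc d => 27 / 2 * ‖x - y‖ ^ 2 * (h - ω.1)⁻¹) μ :=
    (hi.comp_fst _).const_mul _
  have hδi : Integrable (fun ω => ‖δ ω‖ ^ 2) μ := by
    refine hi'.mono' (by fun_prop) (hδle.mono fun ω hω => ?_)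
    rwa [Real.norm_of_nonneg (by positivity)]
  rw [hx, rmStep_eq_map d s₁ h ϱ y hm]
  refine (KLdiv_map_shear_le μ d hδ hT hδi).trans (ENNReal.ofReal_le_ofReal ?_)
  have hlog : 0 ≤ -Real.log (1 - ϱ) := by
    linarith [Real.log_nonpos (by linarith : 0 ≤ 1 - ϱ) (by linarith)]
  calc ∫ ω, ‖δ ω‖ ^ 2 / 2 ∂μ
      ≤ ∫ ω : ℝ × Euc d, 27 / 2 * ‖x - y‖ ^ 2 * (h - ω.1)⁻¹ / 2 ∂μ := by
        refine integral_mono_ae (hδi.div_const 2) (hi'.div_const 2) (hδle.mono fun ω hω => ?_)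
        exact div_le_div_of_nonneg_right hω zero_le_two
    _ = 27 / 4 * ‖x - y‖ ^ 2 * ∫ u, (h - u)⁻¹ ∂(midLaw h ϱ) := by
        rw [hμ, integral_div, integral_const_mul, integral_fun_fst (fun u : ℝ => (h - u)⁻¹)]
        simp
        ring
    _ ≤ 27 / 4 * ‖x - y‖ ^ 2 * (6 / h * -Real.log (1 - ϱ)) := by gcongr
    _ = 81 / 2 * (‖x - y‖ ^ 2 / h) * -Real.log (1 - ϱ) := by ring
    _ ≤ 41 * (‖x - y‖ ^ 2 / h) * Real.log (Real.exp 1 / (1 - ϱ)) := by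
        rw [Real.log_div (Real.exp_pos _).ne' (by linarith), Real.log_exp]
        have : 0 ≤ ‖x - y‖ ^ 2 / h := by positivity
        gcongr
        · norm_num
        · linarith
end
end
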